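/- Fix an integer k ≥ 1, a real α with 0 < α < 1, and a function L_{k,α} : [0,∞) → [0,∞) that is continuous, strictly increasing, concave, satisfies L_{k,α}(0) = 0, and agrees with x / (ln^∘k(x))^α for all sufficiently large x. Then for the simple random walk on ℤ² there exist constants c₁, c₂ > 0 and N such that for all n ≥ N, c₁ · n / (ln^∘(k+1)(n))^α ≤ E[ Σ_{z ∈ ℤ²} L_{k,α}(b_z^(n)) ] ≤ c₂ · n / (ln^∘(k+1)(n))^α. -/

import Mathlib

/-!
The simple random walk on `ℤ²`.  A path of length `n` is a function `Fin n → Fin 4`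
choosing at each time one of the four unit steps, each path having probability `4⁻ⁿ`.
-/

/-- The four unit steps of the simple random walk on `ℤ²`. -/
def stepVec : Fin 4 → ℤ × ℤ := ![(1, 0), (-1, 0), (0, 1), (0, -1)]

/-- The position of the walk after `m` steps, along the path `ω`. -/
def pathPos {n : ℕ} (ω : Fin n → Fin 4) (m : ℕ) : ℤ × ℤ :=
  ∑ i ∈ Finset.univ.filter (fun i : Fin n => (i : ℕ) < m), stepVec (ω i)

/-- The local time `b_z⁽ⁿ⁾`: the number of visits to `z` up to time `n`. -/
def localTime {n : ℕ} (ω : Fin n → Fin 4) (z : ℤ × ℤ) : ℕ :=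
  ((Finset.range (n + 1)).filter (fun m => pathPos ω m = z)).card

/-- Expectation of a functional of the simple random walk path of length `n`
(uniform measure on the `4 ^ n` paths). -/
noncomputable def expectSRW (n : ℕ) (g : (Fin n → Fin 4) → ℝ) : ℝ :=
  (∑ ω : Fin n → Fin 4, g ω) / 4 ^ n


section Expectation

variable {n : ℕ}

lemma expectSRW_mono {f g : (Fin n → Fin 4) → ℝ} (h : ∀ ω, f ω ≤ g ω) :
    expectSRW n f ≤ expectSRW n g := by
  unfold expectSRW
  gcongr with ω
  exact h ω

lemma expectSRW_const (c : ℝ) : expectSRW n (fun _ => c) = c := by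
  simp [expectSRW]

lemma expectSRW_add (f g : (Fin n → Fin 4) → ℝ) :
    expectSRW n (fun ω => f ω + g ω) = expectSRW n f + expectSRW n g := by
  simp [expectSRW, Finset.sum_add_distrib, add_div]

lemma expectSRW_sub (f g : (Fin n → Fin 4) → ℝ) :
    expectSRW n (fun ω => f ω - g ω) = expectSRW n f - expectSRW n g := by
  simp [expectSRW, Finset.sum_sub_distrib, sub_div]

lemma expectSRW_const_mul (c : ℝ) (f : (Fin n → Fin 4) → ℝ) :
    expectSRW n (fun ω => c * f ω) = c * expectSRW n f := by
  simp [expectSRW, ← Finset.mul_sum, mul_div_assoc]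

lemma expectSRW_sum {ι : Type*} (s : Finset ι) (f : ι → (Fin n → Fin 4) → ℝ) :
    expectSRW n (fun ω => ∑ i ∈ s, f i ω) = ∑ i ∈ s, expectSRW n (f i) := by
  simp only [expectSRW]
  rw [Finset.sum_comm, Finset.sum_div]

/-- Functionals depending on complementary sets of steps are uncorrelated. -/
lemma expectSRW_mul_of_dependsOn (T : Finset (Fin n)) {f g : (Fin n → Fin 4) → ℝ}
    (hf : ∀ ω ω', (∀ i ∈ T, ω i = ω' i) → f ω = f ω')
    (hg : ∀ ω ω', (∀ i ∉ T, ω i = ω' i) → g ω = g ω') :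
    expectSRW n (fun ω => f ω * g ω) = expectSRW n f * expectSRW n g := by
  classical
  let φ : (Fin n → Fin 4) × (Fin n → Fin 4) → (Fin n → Fin 4) × (Fin n → Fin 4) :=
    fun p => (fun i => if i ∈ T then p.1 i else p.2 i, fun i => if i ∈ T then p.2 i else p.1 i)
  have hφ : ∀ p, φ (φ p) = p := by
    intro p
    ext i <;> by_cases hi : i ∈ T <;> simp [φ, hi]
  have key : ∑ p : (Fin n → Fin 4) × (Fin n → Fin 4), f p.1 * g p.2
      = ∑ p : (Fin n → Fin 4) × (Fin n → Fin 4), f p.1 * g p.1 := by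
    refine Finset.sum_nbij' φ φ (by simp) (by simp) (by simp [hφ]) (by simp [hφ]) ?_
    intro p _
    congr 1
    · exact hf _ _ fun i hi => by simp [φ, hi]
    · exact hg _ _ fun i hi => by simp [φ, hi]
  rw [Fintype.sum_prod_type, Fintype.sum_prod_type] at key
  simp only [← Finset.mul_sum, ← Finset.sum_mul, Finset.sum_const, Finset.card_univ,
    Fintype.card_fun, Fintype.card_fin, nsmul_eq_mul] at key
  unfold expectSRW
  rw [div_mul_div_comm, key]
  simp only [mul_left_comm _ (((4 ^ n : ℕ) : ℝ)), ← Finset.mul_sum]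
  push_cast
  field_simp

end Expectation

section ReturnProbability

lemma card_filter_card_inter {n i : ℕ} (T : Finset (Fin n)) (hT : T.card = 2 * i) :
    (Finset.univ.filter fun A : Finset (Fin n) => 2 * (A ∩ T).card = T.card).card
      = i.centralBinom * 2 ^ (n - 2 * i) := by
  have h : (Finset.univ.filter fun A : Finset (Fin n) => 2 * (A ∩ T).card = T.card).card
      = (Finset.powersetCard i T ×ˢ Tᶜ.powerset).card := by
    refine Finset.card_nbij' (fun A => (A ∩ T, A \ T)) (fun p => p.1 ∪ p.2) ?_ ?_ ?_ ?_
    · intro A hA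
      simp at hA
      have : (A ∩ T).card = i := by omega
      simp [Finset.mem_powersetCard, this, Finset.inter_subset_right]
    · rintro ⟨B, C⟩ h
      simp [Finset.mem_powersetCard] at h
      obtain ⟨⟨hB, hBi⟩, hC⟩ := h
      have : (B ∪ C) ∩ T = B := by
        ext x
        have h1 := @hB x
        have h2 := @hC x
        simp at h1 h2 ⊢
        tauto
      simp [this, hBi, hT]
    · intro A _
      ext x
      simp
      tauto
    · rintro ⟨B, C⟩ h
      simp [Finset.mem_powersetCard] at h
      obtain ⟨⟨hB, hBi⟩, hC⟩ := h
      ext x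
      all_goals
        have h1 := @hB x
        have h2 := @hC x
        simp at h1 h2 ⊢
        tauto
  rw [h, Finset.card_product, Finset.card_powersetCard, Finset.card_powerset, hT,
    Finset.card_compl, Fintype.card_fin, hT, Nat.centralBinom]

/-- The two rotated coordinates of the walk are independent one-dimensional walks. -/
lemma card_filter_sum_stepVec_eq_zero {n : ℕ} (T : Finset (Fin n)) :
    (Finset.univ.filter fun ω : Fin n → Fin 4 => ∑ i ∈ T, stepVec (ω i) = 0).card
      = (Finset.univ.filter fun A : Finset (Fin n) => 2 * (A ∩ T).card = T.card).card ^ 2 := by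
  let a : (Fin n → Fin 4) → Finset (Fin n) := fun ω =>
    Finset.univ.filter fun i => ω i = 0 ∨ ω i = 2
  let b : (Fin n → Fin 4) → Finset (Fin n) := fun ω =>
    Finset.univ.filter fun i => ω i = 0 ∨ ω i = 3
  have hcard : ∀ A : Finset (Fin n),
      (2 * ((A ∩ T).card : ℤ) - T.card) = ∑ i ∈ T, if i ∈ A then (1 : ℤ) else -1 := by
    intro A
    have h1 : ∀ i ∈ T, (if i ∈ A then (1 : ℤ) else -1) = 2 * (if i ∈ A then 1 else 0) - 1 := by
      intro i _; split_ifs <;> norm_num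
    rw [Finset.sum_congr rfl h1, Finset.sum_sub_distrib, ← Finset.mul_sum, Finset.inter_comm]
    simp
  have hstep : ∀ ω : Fin n → Fin 4, ∑ i ∈ T, stepVec (ω i) = 0 ↔
      2 * (a ω ∩ T).card = T.card ∧ 2 * (b ω ∩ T).card = T.card := by
    intro ω
    have ha : (2 * ((a ω ∩ T).card : ℤ) - T.card)
        = (∑ i ∈ T, stepVec (ω i)).1 + (∑ i ∈ T, stepVec (ω i)).2 := by
      rw [hcard, Prod.fst_sum, Prod.snd_sum, ← Finset.sum_add_distrib]
      refine Finset.sum_congr rfl fun i _ => ?_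
      simp only [a, Finset.mem_filter, Finset.mem_univ, true_and]
      generalize ω i = x
      fin_cases x <;> simp [stepVec]
    have hb : (2 * ((b ω ∩ T).card : ℤ) - T.card)
        = (∑ i ∈ T, stepVec (ω i)).1 - (∑ i ∈ T, stepVec (ω i)).2 := by
      rw [hcard, Prod.fst_sum, Prod.snd_sum, ← Finset.sum_sub_distrib]
      refine Finset.sum_congr rfl fun i _ => ?_
      simp only [b, Finset.mem_filter, Finset.mem_univ, true_and]
      generalize ω i = x
      fin_cases x <;> simp [stepVec]
    rw [Prod.ext_iff]
    simp only [Prod.fst_zero, Prod.snd_zero]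
    omega
  rw [sq, ← Finset.card_product]
  refine Finset.card_nbij' (fun ω => (a ω, b ω))
    (fun p i => if i ∈ p.1 then (if i ∈ p.2 then 0 else 2) else if i ∈ p.2 then 3 else 1)
    ?_ ?_ ?_ ?_
  · intro ω hω
    simpa [hstep] using hω
  · rintro ⟨A, B⟩ h
    have hA : a (fun i => if i ∈ A then (if i ∈ B then 0 else 2) else if i ∈ B then 3 else 1)
        = A := by
      ext i; by_cases h1 : i ∈ A <;> by_cases h2 : i ∈ B <;> simp [a, h1, h2]
    have hB : b (fun i => if i ∈ A then (if i ∈ B then 0 else 2) else if i ∈ B then 3 else 1)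
        = B := by
      ext i; by_cases h1 : i ∈ A <;> by_cases h2 : i ∈ B <;> simp [b, h1, h2]
    simpa [hstep, hA, hB] using h
  · intro ω _
    funext i
    simp only [a, b, Finset.mem_filter, Finset.mem_univ, true_and]
    generalize ω i = x
    fin_cases x <;> simp
  · rintro ⟨A, B⟩ _
    ext i <;> by_cases h1 : i ∈ A <;> by_cases h2 : i ∈ B <;> simp [a, b, h1, h2]

lemma expectSRW_indicator {n : ℕ} (P : (Fin n → Fin 4) → Prop) [DecidablePred P] :
    expectSRW n (fun ω => if P ω then 1 else 0) = (Finset.univ.filter P).card / 4 ^ n := by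
  simp [expectSRW]

lemma expectSRW_sum_stepVec_eq_zero_of_even {n i : ℕ} (T : Finset (Fin n))
    (hT : T.card = 2 * i) :
    expectSRW n (fun ω => if ∑ j ∈ T, stepVec (ω j) = 0 then 1 else 0)
      = ((i.centralBinom : ℝ) / 4 ^ i) ^ 2 := by
  have hle : 2 * i ≤ n := by simpa [hT] using T.card_le_univ
  rw [expectSRW_indicator, card_filter_sum_stepVec_eq_zero, card_filter_card_inter T hT]
  obtain ⟨r, rfl⟩ := Nat.exists_eq_add_of_le hle
  push_cast
  rw [Nat.add_sub_cancel_left, div_pow, mul_pow, div_eq_div_iff (by positivity) (by positivity),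
    pow_add, pow_mul, ← pow_mul 2 r 2, mul_comm r 2, pow_mul]
  norm_num
  rw [← pow_mul 4 i 2, mul_comm i 2, pow_mul]
  norm_num
  ring

lemma centralBinom_div_sq_le (i : ℕ) :
    ((i.centralBinom : ℝ) / 4 ^ i) ^ 2 ≤ 1 / (2 * i + 1) := by
  induction i with
  | zero => simp
  | succ i ih =>
    have h : ((i + 1).centralBinom : ℝ) = 2 * (2 * i + 1) / (i + 1) * i.centralBinom := by
      have := Nat.succ_mul_centralBinom_succ i
      field_simp
      exact_mod_cast by linarith
    have h2 : (((i + 1).centralBinom : ℝ) / 4 ^ (i + 1)) ^ 2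
        = ((2 * i + 1) / (2 * i + 2)) ^ 2 * ((i.centralBinom : ℝ) / 4 ^ i) ^ 2 := by
      rw [h]; field_simp; ring
    rw [h2]
    refine (mul_le_mul_of_nonneg_left ih (by positivity)).trans ?_
    push_cast
    rw [div_pow, div_mul_div_comm, div_le_div_iff₀ (by positivity) (by positivity)]
    have : (0 : ℝ) ≤ i := i.cast_nonneg
    nlinarith

lemma le_centralBinom_div_sq (i : ℕ) :
    1 / (4 * ((i : ℝ) + 1)) ≤ ((i.centralBinom : ℝ) / 4 ^ i) ^ 2 := by
  rcases Nat.eq_zero_or_pos i with rfl | hi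
  · norm_num
  suffices h : 1 / (4 * (i : ℝ)) ≤ ((i.centralBinom : ℝ) / 4 ^ i) ^ 2 by
    refine le_trans ?_ h
    have : (0 : ℝ) < i := by exact_mod_cast hi
    gcongr
    linarith
  induction i, hi using Nat.le_induction with
  | base => norm_num [Nat.centralBinom]
  | succ i hi ih =>
    have h : ((i + 1).centralBinom : ℝ) = 2 * (2 * i + 1) / (i + 1) * i.centralBinom := by
      have := Nat.succ_mul_centralBinom_succ i
      field_simp
      exact_mod_cast by linarith
    have h2 : (((i + 1).centralBinom : ℝ) / 4 ^ (i + 1)) ^ 2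
        = ((2 * i + 1) / (2 * i + 2)) ^ 2 * ((i.centralBinom : ℝ) / 4 ^ i) ^ 2 := by
      rw [h]; field_simp; ring
    rw [h2]
    refine le_trans ?_ (mul_le_mul_of_nonneg_left ih (by positivity))
    have : (0 : ℝ) < i := by exact_mod_cast hi
    push_cast
    rw [div_pow, div_mul_div_comm, div_le_div_iff₀ (by positivity) (by positivity)]
    nlinarith

lemma expectSRW_sum_stepVec_eq_zero_le {n : ℕ} (T : Finset (Fin n)) :
    expectSRW n (fun ω => if ∑ j ∈ T, stepVec (ω j) = 0 then 1 else 0)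
      ≤ 1 / ((T.card : ℝ) + 1) := by
  rcases Nat.even_or_odd' T.card with ⟨i, hi | hi⟩
  · rw [expectSRW_sum_stepVec_eq_zero_of_even T hi, hi]
    push_cast
    exact centralBinom_div_sq_le i
  · rw [expectSRW_indicator, card_filter_sum_stepVec_eq_zero, Finset.filter_false_of_mem]
    · simp; positivity
    · intro A _
      omega

end ReturnProbability

section LocalTime

variable {n : ℕ}

/-- The steps of the walk taken between the times `a` and `b`. -/
def stepsBetween (n a b : ℕ) : Finset (Fin n) :=
  Finset.univ.filter fun i => a ≤ (i : ℕ) ∧ (i : ℕ) < b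

lemma card_stepsBetween {a b : ℕ} (hb : b ≤ n) : (stepsBetween n a b).card = b - a := by
  rw [← Nat.card_Ico, ← Finset.card_map Fin.valEmbedding]
  congr 1
  ext x
  simp only [stepsBetween, Finset.mem_map, Finset.mem_filter, Finset.mem_univ, true_and,
    Fin.valEmbedding_apply, Finset.mem_Ico]
  constructor
  · rintro ⟨i, hi, rfl⟩
    exact hi
  · intro h
    exact ⟨⟨x, by omega⟩, h, rfl⟩

lemma pathPos_add_sum_stepsBetween (ω : Fin n → Fin 4) {a b : ℕ} (hab : a ≤ b) :
    pathPos ω a + ∑ i ∈ stepsBetween n a b, stepVec (ω i) = pathPos ω b := by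
  unfold pathPos stepsBetween
  rw [← Finset.sum_union]
  · congr 1
    ext i
    simp
    omega
  · rw [Finset.disjoint_left]
    intro i
    simp
    omega

lemma pathPos_eq_iff (ω : Fin n → Fin 4) {a b : ℕ} (hab : a ≤ b) :
    pathPos ω a = pathPos ω b ↔ ∑ i ∈ stepsBetween n a b, stepVec (ω i) = 0 := by
  rw [← pathPos_add_sum_stepsBetween ω hab]
  simp

/-- The set of sites visited up to time `n`. -/
def visitedSites (ω : Fin n → Fin 4) : Finset (ℤ × ℤ) :=
  (Finset.range (n + 1)).image (pathPos ω)

lemma localTime_eq_zero {ω : Fin n → Fin 4} {z : ℤ × ℤ} (hz : z ∉ visitedSites ω) :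
    localTime ω z = 0 := by
  rw [localTime, Finset.card_eq_zero, Finset.filter_eq_empty_iff]
  intro m hm h
  exact hz (Finset.mem_image.2 ⟨m, hm, h⟩)

lemma localTime_pos {ω : Fin n → Fin 4} {z : ℤ × ℤ} (hz : z ∈ visitedSites ω) :
    0 < localTime ω z := by
  obtain ⟨m, hm, h⟩ := Finset.mem_image.1 hz
  exact Finset.card_pos.2 ⟨m, by simpa [h] using hm⟩

lemma sum_localTime (ω : Fin n → Fin 4) : ∑ z ∈ visitedSites ω, localTime ω z = n + 1 := by
  have := Finset.card_eq_sum_card_image (pathPos ω) (Finset.range (n + 1))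
  rw [Finset.card_range] at this
  exact this.symm

lemma sum_localTime_sq (ω : Fin n → Fin 4) :
    ∑ z ∈ visitedSites ω, (localTime ω z : ℝ) ^ 2 = ∑ a ∈ Finset.range (n + 1),
      ∑ b ∈ Finset.range (n + 1), if pathPos ω a = pathPos ω b then (1 : ℝ) else 0 := by
  have h1 : ∀ a, (∑ b ∈ Finset.range (n + 1), if pathPos ω a = pathPos ω b then (1 : ℝ) else 0)
      = localTime ω (pathPos ω a) := by
    intro a
    simp [localTime, eq_comm]
  simp only [h1]
  rw [← Finset.sum_fiberwise_of_maps_to (t := visitedSites ω) (g := pathPos ω)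
    (fun a ha => Finset.mem_image_of_mem _ ha)]
  refine Finset.sum_congr rfl fun z _ => ?_
  rw [Finset.sum_congr rfl (g := fun _ => (localTime ω z : ℝ))
    (fun a ha => by rw [(Finset.mem_filter.1 ha).2])]
  simp [localTime, sq]

lemma expectSRW_pathPos_eq_le {a b : ℕ} (hab : a ≤ b) (hb : b ≤ n) :
    expectSRW n (fun ω => if pathPos ω a = pathPos ω b then 1 else 0)
      ≤ 1 / ((b - a : ℕ) + 1 : ℝ) := by
  simp only [pathPos_eq_iff _ hab]
  simpa [card_stepsBetween hb] using expectSRW_sum_stepVec_eq_zero_le (stepsBetween n a b)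

lemma sum_one_div_succ (N : ℕ) :
    ∑ d ∈ Finset.range N, 1 / ((d : ℝ) + 1) = (harmonic N : ℝ) := by
  simp [harmonic]

/-- The expected self-intersection local time is of order at most `n log n`. -/
lemma expectSRW_sum_localTime_sq_le (n : ℕ) :
    expectSRW n (fun ω => ∑ z ∈ visitedSites ω, (localTime ω z : ℝ) ^ 2)
      ≤ (n + 1) * (2 * (1 + Real.log (n + 1))) := by
  simp only [sum_localTime_sq]
  rw [expectSRW_sum]
  simp only [expectSRW_sum]
  have hrow : ∀ a ∈ Finset.range (n + 1), ∑ b ∈ Finset.range (n + 1),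
      expectSRW n (fun ω => if pathPos ω a = pathPos ω b then (1 : ℝ) else 0)
      ≤ 2 * (1 + Real.log (n + 1)) := by
    intro a ha
    have ha' : a ≤ n := by simpa [Nat.lt_succ_iff] using ha
    have hentry : ∀ b ∈ Finset.range (n + 1),
        expectSRW n (fun ω => if pathPos ω a = pathPos ω b then (1 : ℝ) else 0)
        ≤ (if a ≤ b then 1 / ((b - a : ℕ) + 1 : ℝ) else 0)
          + (if b ≤ a then 1 / ((a - b : ℕ) + 1 : ℝ) else 0) := by
      intro b hb
      have hb' : b ≤ n := by simpa [Nat.lt_succ_iff] using hb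
      rcases le_total a b with h | h
      · refine (expectSRW_pathPos_eq_le h hb').trans ?_
        rw [if_pos h]
        have : (0 : ℝ) ≤ if b ≤ a then 1 / ((a - b : ℕ) + 1 : ℝ) else 0 := by positivity
        linarith
      · have := expectSRW_pathPos_eq_le h ha'
        simp only [eq_comm] at this
        refine this.trans ?_
        rw [if_pos h]
        have : (0 : ℝ) ≤ if a ≤ b then 1 / ((b - a : ℕ) + 1 : ℝ) else 0 := by positivity
        linarith
    refine (Finset.sum_le_sum hentry).trans ?_
    rw [Finset.sum_add_distrib, ← Finset.sum_filter, ← Finset.sum_filter]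
    have hH : (harmonic (n + 1) : ℝ) ≤ 1 + Real.log (n + 1) := by
      exact_mod_cast harmonic_le_one_add_log (n + 1)
    have hnn : ∀ d ∈ Finset.range (n + 1), (0 : ℝ) ≤ 1 / ((d : ℝ) + 1) :=
      fun d _ => by positivity
    have h1 : ∑ b ∈ Finset.range (n + 1) with a ≤ b, 1 / ((b - a : ℕ) + 1 : ℝ)
        ≤ harmonic (n + 1) := by
      rw [← sum_one_div_succ,
        ← Finset.sum_image (f := fun d : ℕ => 1 / ((d : ℝ) + 1)) (g := fun b => b - a)]
      · refine Finset.sum_le_sum_of_subset_of_nonneg ?_ fun d hd _ => hnn d hd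
        intro d
        simp
        omega
      · intro x hx y hy hxy
        simp at hx hy hxy
        omega
    have h2 : ∑ b ∈ Finset.range (n + 1) with b ≤ a, 1 / ((a - b : ℕ) + 1 : ℝ)
        ≤ harmonic (n + 1) := by
      rw [← sum_one_div_succ,
        ← Finset.sum_image (f := fun d : ℕ => 1 / ((d : ℝ) + 1)) (g := fun b => a - b)]
      · refine Finset.sum_le_sum_of_subset_of_nonneg ?_ fun d hd _ => hnn d hd
        intro d
        simp
        omega
      · intro x hx y hy hxy
        simp at hx hy hxy
        omega
    linarith
  refine (Finset.sum_le_sum hrow).trans ?_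
  simp

/-- If, for each time `m ∈ I`, the event `F m` does not depend on the steps between `m` and the
time `t m i`, at distance `2 * i` from `m`, and the times in `I` at which `F` occurs are at
distinct positions, then few such times are expected. -/
lemma expectSRW_sum_indicator_le (I : Finset ℕ) (Q : ℕ) (F : ℕ → (Fin n → Fin 4) → Prop)
    [∀ m ω, Decidable (F m ω)] (t : ℕ → ℕ → ℕ) (W : ℕ → ℕ → Finset (Fin n))
    (ht : ∀ m ∈ I, ∀ i ≤ Q, t m i ≤ n)
    (htinj : ∀ m ∈ I, ∀ i ≤ Q, ∀ j ≤ Q, t m i = t m j → i = j)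
    (hW : ∀ m ∈ I, ∀ i ≤ Q, (W m i).card = 2 * i)
    (hWt : ∀ m ∈ I, ∀ i ≤ Q, ∀ ω : Fin n → Fin 4,
      pathPos ω (t m i) = pathPos ω m ↔ ∑ j ∈ W m i, stepVec (ω j) = 0)
    (hF : ∀ m ∈ I, ∀ i ≤ Q, ∀ ω ω' : Fin n → Fin 4,
      (∀ j ∉ W m i, ω j = ω' j) → (F m ω ↔ F m ω'))
    (hFinj : ∀ ω, ∀ m ∈ I, ∀ m' ∈ I, F m ω → F m' ω → pathPos ω m = pathPos ω m' → m = m') :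
    Real.log (Q + 1) / 4 * expectSRW n (fun ω => ∑ m ∈ I, if F m ω then 1 else 0) ≤ n + 1 := by
  classical
  have hG : Real.log (Q + 1) / 4
      ≤ ∑ i ∈ Finset.range (Q + 1), ((i.centralBinom : ℝ) / 4 ^ i) ^ 2 := by
    have h1 : Real.log (Q + 1) ≤ harmonic (Q + 1) := by
      have := log_add_one_le_harmonic (Q + 1)
      refine le_trans (Real.log_le_log (by positivity) ?_) this
      push_cast
      linarith
    refine (div_le_div_of_nonneg_right h1 (by norm_num)).trans ?_
    rw [← sum_one_div_succ, Finset.sum_div]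
    refine Finset.sum_le_sum fun i _ => le_trans (le_of_eq ?_) (le_centralBinom_div_sq i)
    field_simp
  have hE : 0 ≤ expectSRW n (fun ω => ∑ m ∈ I, if F m ω then (1 : ℝ) else 0) := by
    unfold expectSRW
    positivity
  refine (mul_le_mul_of_nonneg_right hG hE).trans ?_
  have hfac : ∀ m ∈ I, ∀ i ∈ Finset.range (Q + 1),
      ((i.centralBinom : ℝ) / 4 ^ i) ^ 2 * expectSRW n (fun ω => if F m ω then 1 else 0)
      = expectSRW n (fun ω => if F m ω ∧ pathPos ω (t m i) = pathPos ω m then 1 else 0) := by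
    intro m hm i hi
    have hi' : i ≤ Q := by simpa [Nat.lt_succ_iff] using hi
    rw [← expectSRW_sum_stepVec_eq_zero_of_even (W m i) (hW m hm i hi'),
      ← expectSRW_mul_of_dependsOn (W m i)]
    · congr 1
      funext ω
      simp only [← hWt m hm i hi' ω]
      by_cases h1 : F m ω <;> by_cases h2 : pathPos ω (t m i) = pathPos ω m <;> simp [h1, h2]
    · intro ω ω' h
      rw [Finset.sum_congr rfl fun j hj => by rw [h j hj]]
    · intro ω ω' h
      simp only [hF m hm i hi' ω ω' h]
  rw [expectSRW_sum, Finset.mul_sum]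
  simp only [Finset.sum_mul]
  rw [Finset.sum_congr rfl fun m hm => Finset.sum_congr rfl (hfac m hm)]
  simp only [← expectSRW_sum]
  rw [← expectSRW_const (n := n) ((n : ℝ) + 1)]
  refine expectSRW_mono fun ω => ?_
  rw [← Finset.sum_product', Finset.sum_boole]
  have : (Finset.filter (fun p : ℕ × ℕ => F p.1 ω ∧ pathPos ω (t p.1 p.2) = pathPos ω p.1)
      (I ×ˢ Finset.range (Q + 1))).card ≤ (Finset.range (n + 1)).card := by
    refine Finset.card_le_card_of_injOn (fun p => t p.1 p.2) ?_ ?_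
    · rintro ⟨m, i⟩ h
      simp at h ⊢
      exact ht m h.1.1 i h.1.2
    · rintro ⟨m, i⟩ h ⟨m', i'⟩ h' heq
      simp at h h' heq
      have hmm : m = m' := hFinj ω m h.1.1 m' h'.1.1 h.2.1 h'.2.1 (by
        rw [← h.2.2, ← h'.2.2, heq])
      subst hmm
      rw [htinj m h.1.1 i h.1.2 i' h'.1.2 heq]
  rw [Finset.card_range] at this
  exact_mod_cast this

/-- The expected number of visited sites is at most of order `n / log n`. -/
lemma expectSRW_card_visitedSites_le (n : ℕ) :
    Real.log ((n / 4 : ℕ) + 1) / 8 * expectSRW n (fun ω => ((visitedSites ω).card : ℝ))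
      ≤ n + 1 := by
  have hfirst := expectSRW_sum_indicator_le (n := n) (Finset.range (n / 2 + 1)) (n / 4)
    (fun m ω => ∀ j ∈ Finset.range m, pathPos ω j ≠ pathPos ω m) (fun m i => m + 2 * i)
    (fun m i => stepsBetween n m (m + 2 * i))
    (by intro m hm i hi; simp at hm; omega)
    (by intro m hm i hi j hj h; omega)
    (by intro m hm i hi; simp at hm; rw [card_stepsBetween (by omega)]; omega)
    (by intro m hm i hi ω; rw [eq_comm, pathPos_eq_iff ω (by omega)])
    (by
      intro m hm i hi ω ω' h
      have hpos : ∀ j ≤ m, pathPos ω j = pathPos ω' j := by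
        intro j hj
        refine Finset.sum_congr rfl fun x hx => ?_
        rw [h x]
        simp [stepsBetween] at hx ⊢
        omega
      refine forall₂_congr fun j hj => ?_
      simp at hj
      rw [hpos j (by omega), hpos m le_rfl])
    (by
      intro ω m hm m' hm' h h' heq
      rcases lt_trichotomy m m' with hlt | rfl | hlt
      · exact absurd heq (h' m (by simpa using hlt))
      · rfl
      · exact absurd heq.symm (h m' (by simpa using hlt)))
  have hlast := expectSRW_sum_indicator_le (n := n) (Finset.Ioc (n / 2) n) (n / 4)
    (fun m ω => ∀ j ∈ Finset.Ioc m n, pathPos ω j ≠ pathPos ω m) (fun m i => m - 2 * i)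
    (fun m i => stepsBetween n (m - 2 * i) m)
    (by intro m hm i hi; simp at hm; omega)
    (by intro m hm i hi j hj h; simp at hm; omega)
    (by intro m hm i hi; simp at hm; rw [card_stepsBetween (by omega)]; omega)
    (by intro m hm i hi ω; rw [pathPos_eq_iff ω (by omega)])
    (by
      intro m hm i hi ω ω' h
      refine forall₂_congr fun j hj => ?_
      simp at hj
      rw [ne_comm, ne_comm (b := pathPos ω' m), Ne, Ne, pathPos_eq_iff ω hj.1.le,
        pathPos_eq_iff ω' hj.1.le, Finset.sum_congr rfl fun x hx => ?_]
      rw [h x]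
      simp [stepsBetween] at hx ⊢
      omega)
    (by
      intro ω m hm m' hm' h h' heq
      simp at hm hm'
      rcases lt_trichotomy m m' with hlt | rfl | hlt
      · exact absurd heq.symm (h m' (by simp; omega))
      · rfl
      · exact absurd heq (h' m (by simp; omega)))
  have hcover : expectSRW n (fun ω => ((visitedSites ω).card : ℝ))
      ≤ expectSRW n (fun ω => ∑ m ∈ Finset.range (n / 2 + 1),
          if (∀ j ∈ Finset.range m, pathPos ω j ≠ pathPos ω m) then (1 : ℝ) else 0)
        + expectSRW n (fun ω => ∑ m ∈ Finset.Ioc (n / 2) n,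
          if (∀ j ∈ Finset.Ioc m n, pathPos ω j ≠ pathPos ω m) then (1 : ℝ) else 0) := by
    rw [← expectSRW_add]
    refine expectSRW_mono fun ω => ?_
    rw [Finset.sum_boole, Finset.sum_boole]
    norm_cast
    set A := Finset.filter (fun m => ∀ j ∈ Finset.range m, pathPos ω j ≠ pathPos ω m)
      (Finset.range (n / 2 + 1)) with hA
    set B := Finset.filter (fun m => ∀ j ∈ Finset.Ioc m n, pathPos ω j ≠ pathPos ω m)
      (Finset.Ioc (n / 2) n) with hB
    have hsub : visitedSites ω ⊆ A.image (pathPos ω) ∪ B.image (pathPos ω) := by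
      intro z hz
      obtain ⟨m, hm, rfl⟩ := Finset.mem_image.1 hz
      simp only [Finset.mem_range] at hm
      set V := (Finset.range (n + 1)).filter fun j => pathPos ω j = pathPos ω m with hV
      have hmV : m ∈ V := by simp [hV]; omega
      have hne : V.Nonempty := ⟨m, hmV⟩
      rcases le_or_gt m (n / 2) with h | h
      · have h1 := V.min'_mem hne
        have h2 := V.min'_le m hmV
        set a := V.min' hne with ha
        simp only [hV, Finset.mem_filter, Finset.mem_range] at h1
        refine Finset.mem_union_left _ (Finset.mem_image.2 ⟨a, ?_, h1.2⟩)
        simp only [hA, Finset.mem_filter, Finset.mem_range]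
        refine ⟨by omega, fun j hj hja => ?_⟩
        have := V.min'_le j (by simp [hV, hja, h1.2]; omega)
        omega
      · have h1 := V.max'_mem hne
        have h2 := V.le_max' m hmV
        set a := V.max' hne with ha
        simp only [hV, Finset.mem_filter, Finset.mem_range] at h1
        refine Finset.mem_union_right _ (Finset.mem_image.2 ⟨a, ?_, h1.2⟩)
        simp only [hB, Finset.mem_filter, Finset.mem_Ioc]
        refine ⟨by omega, fun j hj hja => ?_⟩
        have := V.le_max' j (by simp [hV, hja, h1.2]; omega)
        omega
    calc (visitedSites ω).card ≤ _ := Finset.card_le_card hsub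
      _ ≤ _ := Finset.card_union_le _ _
      _ ≤ A.card + B.card := add_le_add Finset.card_image_le Finset.card_image_le
  have hlog : 0 ≤ Real.log ((n / 4 : ℕ) + 1) := Real.log_nonneg (by
    have : (0 : ℝ) ≤ (n / 4 : ℕ) := Nat.cast_nonneg _
    linarith)
  have := mul_le_mul_of_nonneg_left hcover (by positivity : 0 ≤ Real.log ((n / 4 : ℕ) + 1) / 8)
  linarith

lemma expectSRW_card_visitedSites_le_div_log (hn : 16 ≤ n) :
    expectSRW n (fun ω => ((visitedSites ω).card : ℝ)) ≤ 32 * n / Real.log n := by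
  have hn' : (16 : ℝ) ≤ n := by exact_mod_cast hn
  have hR0 : 0 ≤ expectSRW n (fun ω => ((visitedSites ω).card : ℝ)) := by
    unfold expectSRW
    positivity
  have hq : Real.log n / 2 ≤ Real.log ((n / 4 : ℕ) + 1) := by
    have hfloor : (n : ℝ) / 4 ≤ (n / 4 : ℕ) + 1 := by
      have h : n ≤ 4 * (n / 4 + 1) := by omega
      have h' : (n : ℝ) ≤ 4 * ((n / 4 : ℕ) + 1) := by exact_mod_cast h
      linarith
    rw [← Real.log_sqrt (by positivity)]
    refine Real.log_le_log (by positivity) (le_trans ?_ hfloor)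
    rw [Real.sqrt_le_left (by positivity)]
    nlinarith
  have h := expectSRW_card_visitedSites_le n
  have h' := mul_le_mul_of_nonneg_right (div_le_div_of_nonneg_right hq
    (by norm_num : (0 : ℝ) ≤ 8)) hR0
  rw [le_div_iff₀ (Real.log_pos (by linarith))]
  linarith

end LocalTime

section IteratedLog

open Filter

lemma tendsto_iterate_log_atTop (k : ℕ) : Tendsto (Real.log^[k]) atTop atTop :=
  Real.tendsto_log_atTop.iterate k

lemma eventually_iterate_log_sq_le {k : ℕ} (hk : 1 ≤ k) :
    ∀ᶠ y in atTop, Real.log^[k] (y ^ 2) ≤ 2 * Real.log^[k] y := by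
  induction k, hk using Nat.le_induction with
  | base => exact Eventually.of_forall fun y => by simp
  | succ k _ ih =>
    have hsq : Tendsto (fun y : ℝ => y ^ 2) atTop atTop := tendsto_pow_atTop two_ne_zero
    filter_upwards [ih, (tendsto_iterate_log_atTop k).eventually_ge_atTop 2,
      ((tendsto_iterate_log_atTop k).comp hsq).eventually_gt_atTop 0] with y h1 h2 h3
    simp only [Function.comp_apply] at h3
    rw [Function.iterate_succ_apply', Function.iterate_succ_apply']
    calc Real.log (Real.log^[k] (y ^ 2)) ≤ Real.log (2 * Real.log^[k] y) := Real.log_le_log h3 h1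
      _ ≤ Real.log (Real.log^[k] y ^ 2) := Real.log_le_log (by positivity) (by nlinarith)
      _ = 2 * Real.log (Real.log^[k] y) := by simp

lemma eventually_iterate_log_le_log {k : ℕ} (hk : 1 ≤ k) :
    ∀ᶠ y in atTop, Real.log^[k] y ≤ Real.log y := by
  induction k, hk using Nat.le_induction with
  | base => exact Eventually.of_forall fun y => by simp
  | succ k _ ih =>
    filter_upwards [ih, (tendsto_iterate_log_atTop k).eventually_ge_atTop 0] with y h1 h2
    rw [Function.iterate_succ_apply']
    exact (Real.log_le_self h2).trans h1

end IteratedLog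

section Concave

lemma ConcaveOn.mul_le_mul_of_map_zero {L : ℝ → ℝ} (hconc : ConcaveOn ℝ (Set.Ici 0) L)
    (hL0 : L 0 = 0) {x y : ℝ} (hx : 0 ≤ x) (hxy : x ≤ y) : x * L y ≤ y * L x := by
  rcases (hx.trans hxy).eq_or_lt with h | hy
  · obtain rfl : x = y := le_antisymm hxy (h ▸ hx)
    exact le_rfl
  have h := hconc.2 (Set.mem_Ici.2 hy.le) (Set.mem_Ici.2 le_rfl)
    (by positivity : 0 ≤ x / y) (sub_nonneg.2 ((div_le_one hy).2 hxy)) (by ring)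
  simp only [smul_eq_mul, hL0, mul_zero, add_zero, div_mul_cancel₀ x hy.ne'] at h
  rwa [div_mul_eq_mul_div, div_le_iff₀ hy, mul_comm (L x)] at h

variable {n : ℕ} {L : ℝ → ℝ}

lemma tsum_localTime (hL0 : L 0 = 0) (ω : Fin n → Fin 4) :
    ∑' z : ℤ × ℤ, L (localTime ω z) = ∑ z ∈ visitedSites ω, L (localTime ω z) :=
  tsum_eq_sum fun z hz => by rw [localTime_eq_zero hz, Nat.cast_zero, hL0]

/-- Lower bound by truncating the local times at a level `B`. -/
lemma le_expectSRW_tsum_localTime (n : ℕ) (hconc : ConcaveOn ℝ (Set.Ici 0) L)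
    (hnonneg : ∀ x ∈ Set.Ici (0 : ℝ), 0 ≤ L x) (hL0 : L 0 = 0) {B : ℝ} (hB : 0 < B) :
    L B / B * ((n + 1) * (1 - 2 * (1 + Real.log (n + 1)) / B))
      ≤ expectSRW n (fun ω => ∑' z : ℤ × ℤ, L (localTime ω z)) := by
  have hLB : 0 ≤ L B / B := div_nonneg (hnonneg B hB.le) hB.le
  have hpt : ∀ x : ℝ, 0 ≤ x → L B / B * (x - 1 / B * x ^ 2) ≤ L x := by
    intro x hx
    rcases le_total x B with h | h
    · have h1 : L B / B * x ≤ L x := by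
        rw [div_mul_eq_mul_div, div_le_iff₀ hB]
        linarith [hconc.mul_le_mul_of_map_zero hL0 hx h]
      have h2 : 0 ≤ L B / B * (1 / B * x ^ 2) := by positivity
      linarith
    · refine le_trans ?_ (hnonneg x hx)
      refine mul_nonpos_of_nonneg_of_nonpos hLB ?_
      have : x * 1 ≤ x * (x / B) := by
        gcongr
        exact (one_le_div hB).2 h
      have h2 : 1 / B * x ^ 2 = x * (x / B) := by ring
      linarith
  have hE : expectSRW n (fun ω => L B / B *
      (((n : ℝ) + 1) - 1 / B * ∑ z ∈ visitedSites ω, (localTime ω z : ℝ) ^ 2))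
      ≤ expectSRW n (fun ω => ∑' z : ℤ × ℤ, L (localTime ω z)) := by
    refine expectSRW_mono fun ω => ?_
    have hs : ((n : ℝ) + 1) = ∑ z ∈ visitedSites ω, (localTime ω z : ℝ) := by
      exact_mod_cast (sum_localTime ω).symm
    rw [tsum_localTime hL0, hs, Finset.mul_sum, ← Finset.sum_sub_distrib, Finset.mul_sum]
    exact Finset.sum_le_sum fun z _ => hpt _ (Nat.cast_nonneg _)
  refine le_trans ?_ hE
  rw [expectSRW_const_mul, expectSRW_sub, expectSRW_const, expectSRW_const_mul]
  refine mul_le_mul_of_nonneg_left ?_ hLB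
  have h := mul_le_mul_of_nonneg_left (expectSRW_sum_localTime_sq_le n)
    (by positivity : 0 ≤ 1 / B)
  have h2 : ((n : ℝ) + 1) * (1 - 2 * (1 + Real.log (n + 1)) / B)
      = (n + 1) - 1 / B * ((n + 1) * (2 * (1 + Real.log (n + 1)))) := by ring
  linarith

/-- Upper bound by separating the sites with local time below and above a level `B`. -/
lemma expectSRW_tsum_localTime_le (n : ℕ) (hconc : ConcaveOn ℝ (Set.Ici 0) L)
    (hnonneg : ∀ x ∈ Set.Ici (0 : ℝ), 0 ≤ L x) (hL0 : L 0 = 0) {B : ℝ} (hB : 0 < B) :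
    expectSRW n (fun ω => ∑' z : ℤ × ℤ, L (localTime ω z))
      ≤ L 1 * B * expectSRW n (fun ω => ((visitedSites ω).card : ℝ)) + L B / B * (n + 1) := by
  have hLB : 0 ≤ L B / B := div_nonneg (hnonneg B hB.le) hB.le
  have hL1 : 0 ≤ L 1 := hnonneg 1 (Set.mem_Ici.2 zero_le_one)
  have hpt : ∀ x : ℝ, 1 ≤ x → L x ≤ L 1 * B + L B / B * x := by
    intro x hx
    rcases le_total x B with h | h
    · have h1 := hconc.mul_le_mul_of_map_zero hL0 zero_le_one hx
      have h2 : 0 ≤ L B / B * x := by positivity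
      have h3 := mul_le_mul_of_nonneg_left h hL1
      linarith
    · have h1 := hconc.mul_le_mul_of_map_zero hL0 hB.le h
      have h2 : L x ≤ L B / B * x := by
        rw [div_mul_eq_mul_div, le_div_iff₀ hB]
        linarith
      have h3 : 0 ≤ L 1 * B := by positivity
      linarith
  rw [← expectSRW_const_mul, ← expectSRW_const (n := n) (L B / B * (n + 1)), ← expectSRW_add]
  refine expectSRW_mono fun ω => ?_
  have hs : ((n : ℝ) + 1) = ∑ z ∈ visitedSites ω, (localTime ω z : ℝ) := by
    exact_mod_cast (sum_localTime ω).symm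
  rw [tsum_localTime hL0, hs, Finset.mul_sum]
  refine (Finset.sum_le_sum fun z hz =>
    hpt _ (by exact_mod_cast localTime_pos hz)).trans (le_of_eq ?_)
  rw [Finset.sum_add_distrib, Finset.sum_const, nsmul_eq_mul, mul_comm (L 1 * B)]

end Concave

/-- Fix `k ≥ 1`, `0 < α < 1`, and a continuous strictly increasing
concave function `L : [0,∞) → [0,∞)` with `L 0 = 0` agreeing with
`x / (ln^[k] x)^α` for all sufficiently large `x`.  Then for the simple random walk
on `ℤ²` there exist `c₁, c₂ > 0` and `N` such that for all `n ≥ N`,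
`c₁ · n / (ln^[k+1] n)^α ≤ E[Σ_{z ∈ ℤ²} L(b_z⁽ⁿ⁾)] ≤ c₂ · n / (ln^[k+1] n)^α`. -/
theorem expected_local_time_iterated_log (k : ℕ) (hk : 1 ≤ k) (α : ℝ)
    (hα0 : 0 < α) (hα1 : α < 1) (L : ℝ → ℝ)
    (hcont : ContinuousOn L (Set.Ici 0))
    (hmono : StrictMonoOn L (Set.Ici 0))
    (hconc : ConcaveOn ℝ (Set.Ici 0) L)
    (hnonneg : ∀ x ∈ Set.Ici (0 : ℝ), 0 ≤ L x)
    (hL0 : L 0 = 0)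
    (heq : ∃ X : ℝ, ∀ x : ℝ, X < x → L x = x / (Real.log^[k] x) ^ α) :
    ∃ c₁ > (0 : ℝ), ∃ c₂ > (0 : ℝ), ∃ N : ℕ, ∀ n : ℕ, N ≤ n →
      c₁ * ((n : ℝ) / (Real.log^[k + 1] (n : ℝ)) ^ α)
          ≤ expectSRW n (fun ω => ∑' z : ℤ × ℤ, L (localTime ω z)) ∧
      expectSRW n (fun ω => ∑' z : ℤ × ℤ, L (localTime ω z))
          ≤ c₂ * ((n : ℝ) / (Real.log^[k + 1] (n : ℝ)) ^ α) := by
  obtain ⟨X, hX⟩ := heq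
  have hL1 : 0 ≤ L 1 := hnonneg 1 (Set.mem_Ici.2 zero_le_one)
  have hlog : Filter.Tendsto (fun n : ℕ => Real.log (n : ℝ)) Filter.atTop Filter.atTop :=
    Real.tendsto_log_atTop.comp tendsto_natCast_atTop_atTop
  have hsqrt := Real.tendsto_sqrt_atTop
  have hy : ∀ᶠ y : ℝ in Filter.atTop, X < √y ∧ 100 ≤ y ∧ 1 ≤ Real.log^[k] y ∧
      0 < Real.log^[k] (√y) ∧ 0 < Real.log^[k] (y ^ 2) ∧ Real.log^[k] (y ^ 2) ≤ 2 * Real.log^[k] y ∧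
      Real.log^[k] y ≤ 2 * Real.log^[k] (√y) ∧ Real.log^[k] y ≤ Real.log y := by
    filter_upwards [hsqrt.eventually_gt_atTop X, Filter.eventually_ge_atTop 100,
      (tendsto_iterate_log_atTop k).eventually_ge_atTop 1,
      ((tendsto_iterate_log_atTop k).comp hsqrt).eventually_gt_atTop 0,
      ((tendsto_iterate_log_atTop k).comp
        (Filter.tendsto_pow_atTop two_ne_zero)).eventually_gt_atTop 0,
      eventually_iterate_log_sq_le hk, hsqrt.eventually (eventually_iterate_log_sq_le hk),
      eventually_iterate_log_le_log hk] with y h1 h2 h3 h4 h5 h6 h7 h8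
    rw [Real.sq_sqrt (by linarith)] at h7
    exact ⟨h1, h2, h3, h4, h5, h6, h7, h8⟩
  obtain ⟨N, hN⟩ := Filter.eventually_atTop.1
    ((hlog.eventually hy).and (Filter.eventually_ge_atTop 16))
  refine ⟨1 / (2 * 2 ^ α), by positivity, 64 * L 1 + 2 * 2 ^ α, by positivity, N, fun n hn => ?_⟩
  obtain ⟨⟨h1, h2, h3, h4, h5, h6, h7, h8⟩, hn16⟩ := hN n hn
  rw [Function.iterate_succ_apply]
  set y := Real.log (n : ℝ)
  set g := Real.log^[k] y
  have hn16' : (16 : ℝ) ≤ n := by exact_mod_cast hn16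
  have hgα : 0 < g ^ α := by positivity
  have hy1 : √y ≤ y ^ 2 := by
    have : √y ≤ y := by rw [Real.sqrt_le_left (by linarith)]; nlinarith
    nlinarith
  have hB2 : L (y ^ 2) / y ^ 2 = 1 / (Real.log^[k] (y ^ 2)) ^ α := by
    rw [hX _ (h1.trans_le hy1)]
    field_simp
  have hspos : 0 < √y := Real.sqrt_pos.2 (by linarith)
  have hB1 : L √y / √y = 1 / (Real.log^[k] (√y)) ^ α := by
    rw [hX _ h1]
    field_simp
  constructor
  · refine le_trans ?_ (le_expectSRW_tsum_localTime n hconc hnonneg hL0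
      (by positivity : 0 < y ^ 2))
    have hlogn : Real.log (n + 1) ≤ 2 * y := by
      have : Real.log ((n : ℝ) + 1) ≤ Real.log ((n : ℝ) ^ 2) :=
        Real.log_le_log (by positivity) (by nlinarith)
      simpa using this
    have hhalf : 2 * (1 + Real.log (n + 1)) / y ^ 2 ≤ 1 / 2 := by
      rw [div_le_iff₀ (by positivity)]
      nlinarith
    have hLB : 1 / (2 ^ α * g ^ α) ≤ L (y ^ 2) / y ^ 2 := by
      rw [hB2, ← Real.mul_rpow (by norm_num) (by linarith)]
      gcongr
    calc 1 / (2 * 2 ^ α) * (n / g ^ α) = 1 / (2 ^ α * g ^ α) * (n * (1 / 2)) := by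
          field_simp
      _ ≤ L (y ^ 2) / y ^ 2 * ((n + 1) * (1 - 2 * (1 + Real.log (n + 1)) / y ^ 2)) := by
          have hLB0 : 0 ≤ L (y ^ 2) / y ^ 2 := by rw [hB2]; positivity
          gcongr
          · linarith
          · linarith
  · refine (expectSRW_tsum_localTime_le n hconc hnonneg hL0 hspos).trans ?_
    have hR : expectSRW n (fun ω => ((visitedSites ω).card : ℝ)) ≤ 32 * n / y :=
      expectSRW_card_visitedSites_le_div_log hn16
    have hg2 : g ^ α ≤ 2 * √y := by
      calc g ^ α ≤ g ^ (1 : ℝ) := Real.rpow_le_rpow_of_exponent_le h3 hα1.le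
        _ = g := Real.rpow_one g
        _ ≤ Real.log y := h8
        _ = 2 * Real.log √y := by rw [Real.log_sqrt (by linarith)]; ring
        _ ≤ 2 * √y := by gcongr; exact Real.log_le_self hspos.le
    have hfirst : L 1 * √y * expectSRW n (fun ω => ((visitedSites ω).card : ℝ))
        ≤ 64 * L 1 * (n / g ^ α) := by
      calc L 1 * √y * expectSRW n (fun ω => ((visitedSites ω).card : ℝ))
          ≤ L 1 * √y * (32 * n / y) := by gcongr
        _ = 64 * L 1 * (n / (2 * √y)) := by
          have : y = √y * √y := (Real.mul_self_sqrt (by linarith)).symm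
          rw [show 32 * (n : ℝ) / y = 32 * n / (√y * √y) by rw [← this]]
          field_simp
          ring
        _ ≤ 64 * L 1 * (n / g ^ α) := by gcongr
    have hsecond : L √y / √y * (n + 1) ≤ 2 * 2 ^ α * (n / g ^ α) := by
      have hLB : L √y / √y ≤ 2 ^ α / g ^ α := by
        rw [hB1, div_le_div_iff₀ (by positivity) hgα, one_mul,
          ← Real.mul_rpow (by norm_num) h4.le]
        gcongr
      calc L √y / √y * (n + 1) ≤ 2 ^ α / g ^ α * (2 * n) := by
            gcongr
            linarith
        _ = 2 * 2 ^ α * (n / g ^ α) := by ring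
    linarith
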